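/- arXiv:1311.7274 — 4 statements merged into one kernel-verified Lean document; each statement's English description precedes it below -/
import Mathlib

section
/- Let p and q be coprime positive integers with q ≡ 1 (mod 4), let m be an integer, and let φ be an integer with 4p·φ ≡ 1 (mod q). Then G(-p, m, q) = √q · (p|q) · exp(2πi φ m²/q), where (p|q) denotes the Jacobi symbol. -/
/-- The generalized quadratic Gauss sum
`G(a, b, c) = ∑_{l=0}^{c-1} exp(2πi(a l² + b l)/c)`. -/
noncomputable def gaussG (a b : ℤ) (c : ℕ) : ℂ :=
  ∑ l ∈ Finset.range c,
    Complex.exp (2 * (Real.pi : ℂ) * Complex.I *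
      ((a : ℂ) * (l : ℂ) ^ 2 + (b : ℂ) * (l : ℂ)) / (c : ℂ))

open Complex Filter Topology

/-- The Jacobi theta function at a real first argument tends to `1` at the cusp `i∞`. -/
theorem tendsto_jacobiTheta₂_ofReal_im_atTop (x : ℝ) :
    Tendsto (jacobiTheta₂ x) (comap im atTop) (𝓝 1) := by
  have hlim : ∀ n : ℤ, Tendsto (jacobiTheta₂_term n x) (comap im atTop)
      (𝓝 (if n = 0 then 1 else 0)) := by
    intro n
    split_ifs with hn
    · have : jacobiTheta₂_term n x = fun _ => 1 := by
        funext τ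
        simp [jacobiTheta₂_term, hn]
      rw [this]
      exact tendsto_const_nhds
    · rw [tendsto_zero_iff_norm_tendsto_zero]
      simp only [norm_jacobiTheta₂_term, ofReal_im, mul_zero, sub_zero]
      refine Real.tendsto_exp_atBot.comp ?_
      have hneg : -Real.pi * (n : ℝ) ^ 2 < 0 := by
        have : (n : ℝ) ≠ 0 := by exact_mod_cast hn
        exact mul_neg_of_neg_of_pos (neg_lt_zero.mpr Real.pi_pos) (by positivity)
      exact tendsto_comap.const_mul_atTop_of_neg hneg
  have hsum := summable_pow_mul_jacobiTheta₂_term_bound 0 one_pos 0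
  have key := tendsto_tsum_of_dominated_convergence hsum hlim (by
    have : ∀ᶠ τ : ℂ in comap im atTop, 1 ≤ im τ := tendsto_comap.eventually_ge_atTop 1
    filter_upwards [this] with τ hτ n
    simpa using norm_jacobiTheta₂_term_le one_pos (z := x) (S := 0) (by simp) hτ n)
  rw [tsum_ite_eq] at key
  exact key

theorem sq_mul_cpow_half {r : ℝ} (hr : 0 < r) (z : ℂ) :
    ((r : ℂ) ^ 2 * z) ^ (1 / 2 : ℂ) = r * z ^ (1 / 2 : ℂ) := by
  rcases eq_or_ne z 0 with rfl | hz
  · simp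
  have hr' : (r : ℂ) ≠ 0 := by exact_mod_cast hr.ne'
  rw [cpow_def_of_ne_zero (mul_ne_zero (pow_ne_zero 2 hr') hz), cpow_def_of_ne_zero hz,
    ← ofReal_pow, log_ofReal_mul (by positivity) hz, Real.log_pow, add_mul, Complex.exp_add]
  congr 1
  rw [show ((((2 : ℕ) : ℝ) * Real.log r : ℝ) : ℂ) * (1 / 2) = (Real.log r : ℂ) by
    push_cast; ring, ← ofReal_exp, Real.exp_log hr]

/-- The theta function near the rational point `a / c`, expanded by the residues modulo `c`. -/
theorem jacobiTheta₂_zero_rat_add {a : ℤ} {c : ℕ} (hc : 0 < c) (hac : Even (a * c)) {w : ℂ}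
    (hw : 0 < w.im) :
    jacobiTheta₂ 0 (a / c + w) =
      (1 / (c * (-I * w) ^ (1 / 2 : ℂ))) *
        ∑ r ∈ Finset.range c, cexp (Real.pi * I * a * r ^ 2 / c) *
          jacobiTheta₂ ((r / c : ℝ) : ℂ) (-1 / (c ^ 2 * w)) := by
  have : NeZero c := ⟨hc.ne'⟩
  have hc0 : (c : ℂ) ≠ 0 := by exact_mod_cast hc.ne'
  have hw0 : w ≠ 0 := by rintro rfl; simp at hw
  have him : 0 < ((a / c + w : ℂ)).im := by
    have : ((a / c : ℂ)).im = 0 := by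
      rw [show (a / c : ℂ) = ((a / c : ℝ) : ℂ) by push_cast; rfl, ofReal_im]
    rw [add_im, this]; simpa
  have h1 := (((Equiv.prodComm (Fin c) ℤ).trans (Int.divModEquiv c).symm).hasSum_iff).mpr
    (hasSum_jacobiTheta₂_term 0 him)
  have hterm : ∀ (r : Fin c) (k : ℤ),
      jacobiTheta₂_term (k * c + (r : ℕ)) 0 (a / c + w) =
        cexp (Real.pi * I * a * (r : ℕ) ^ 2 / c) * cexp (Real.pi * I * (r : ℕ) ^ 2 * w) *
          jacobiTheta₂_term k ((r : ℕ) * c * w) (c ^ 2 * w) := by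
    intro r k
    obtain ⟨b, hb⟩ := hac
    have hb' : (a : ℂ) * c = b + b := by exact_mod_cast hb
    simp only [jacobiTheta₂_term]
    rw [← Complex.exp_add, ← Complex.exp_add, Complex.exp_eq_exp_iff_exists_int]
    refine ⟨(r : ℕ) * k * a + k ^ 2 * b, ?_⟩
    push_cast
    have hb2 : (b : ℂ) = a * c / 2 := by rw [hb']; ring
    rw [hb2]
    field_simp
    ring
  have hfiber : ∀ r : Fin c, HasSum
      (fun k : ℤ => jacobiTheta₂_term (k * c + (r : ℕ)) 0 (a / c + w))
      (1 / (c * (-I * w) ^ (1 / 2 : ℂ)) * (cexp (Real.pi * I * a * (r : ℕ) ^ 2 / c) *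
          jacobiTheta₂ (((r : ℕ) / c : ℝ) : ℂ) (-1 / (c ^ 2 * w)))) := by
    intro r
    have him' : 0 < ((c : ℂ) ^ 2 * w).im := by
      rw [← ofReal_natCast, ← ofReal_pow, im_ofReal_mul]
      have : (0 : ℝ) < c := by exact_mod_cast hc
      positivity
    simp only [hterm]
    convert! (hasSum_jacobiTheta₂_term ((r : ℕ) * c * w) him').mul_left _ using 1
    rw [jacobiTheta₂_functional_equation ((r : ℕ) * c * w)]
    have e1 : (-I * ((c : ℂ) ^ 2 * w)) ^ (1 / 2 : ℂ) = c * (-I * w) ^ (1 / 2 : ℂ) := by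
      rw [← ofReal_natCast, ← sq_mul_cpow_half (by exact_mod_cast hc)]
      congr 1
      ring
    have e2 : ((r : ℕ) * c * w : ℂ) / (c ^ 2 * w) = (((r : ℕ) / c : ℝ) : ℂ) := by
      push_cast
      field_simp
    have e3 : cexp (Real.pi * I * (r : ℕ) ^ 2 * w) *
        cexp (-Real.pi * I * ((r : ℕ) * c * w) ^ 2 / (c ^ 2 * w)) = 1 := by
      rw [← Complex.exp_add, ← Complex.exp_zero]
      congr 1
      field_simp
      ring
    rw [e1, e2]
    linear_combination (-(1 / (c * (-I * w) ^ (1 / 2 : ℂ)) *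
      (cexp (Real.pi * I * a * (r : ℕ) ^ 2 / c) *
          jacobiTheta₂ (((r : ℕ) / c : ℝ) : ℂ) (-1 / (c ^ 2 * w))))) * e3
  have h2 := h1.prod_fiberwise hfiber
  rw [h2.unique (hasSum_fintype _), ← Finset.mul_sum, Finset.sum_range]

/-- The **Landsberg–Schaar relation**. -/
theorem landsberg_schaar {a c : ℕ} (ha : 0 < a) (hc : 0 < c) (hac : Even (a * c)) :
    ∑ r ∈ Finset.range c, cexp (Real.pi * I * a * r ^ 2 / c) =
      1 / (-I * (a / c)) ^ (1 / 2 : ℂ) *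
        ∑ r ∈ Finset.range a, cexp (-(Real.pi * I * c * r ^ 2 / a)) := by
  have hc0 : (c : ℂ) ≠ 0 := by exact_mod_cast hc.ne'
  have ha0 : (a : ℂ) ≠ 0 := by exact_mod_cast ha.ne'
  have ha' : (0 : ℝ) < a := by exact_mod_cast ha
  have hc' : (0 : ℝ) < c := by exact_mod_cast hc
  have hden : ∀ t : ℝ, (a + I * t * c : ℂ) ≠ 0 := by
    intro t h
    have := congrArg re h
    simp at this
    exact ha.ne' this
  set v : ℝ → ℂ := fun t => c ^ 2 / (a * (a + I * t * c)) with hv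
  have hvt : Tendsto v (𝓝[>] 0) (𝓝 (((c / a : ℝ) : ℂ) ^ 2 * 1)) := by
    have : ContinuousAt v 0 := by
      refine ContinuousAt.div (by fun_prop) (by fun_prop) (mul_ne_zero ha0 (hden 0))
    have h := this.tendsto.mono_left (nhdsWithin_le_nhds (s := Set.Ioi 0))
    convert h using 2
    simp only [hv]
    push_cast
    simp
    field_simp
  have hinv : ∀ t : ℝ, 0 < t → -1 / ((a : ℂ) ^ 2 * (I * t * v t)) =
      ((-1 / (a * c) : ℝ) : ℂ) + ((1 / (c ^ 2 * t) : ℝ) : ℂ) * I := by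
    intro t ht
    have ht0 : (t : ℂ) ≠ 0 := by exact_mod_cast ht.ne'
    have := hden t
    simp only [hv]
    push_cast
    field_simp
    linear_combination (-a : ℂ) * I_sq
  have hinv' : ∀ t : ℝ, 0 < t → -1 / ((c : ℂ) ^ 2 * (I * t)) =
      ((1 / (c ^ 2 * t) : ℝ) : ℂ) * I := by
    intro t ht
    have ht0 : (t : ℂ) ≠ 0 := by exact_mod_cast ht.ne'
    push_cast
    field_simp
    linear_combination (-1 : ℂ) * I_sq
  have htop : Tendsto (fun t : ℝ => 1 / (c ^ 2 * t)) (𝓝[>] 0) atTop := by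
    have := tendsto_inv_nhdsGT_zero (𝕜 := ℝ) |>.const_mul_atTop
      (show (0 : ℝ) < 1 / c ^ 2 by positivity)
    refine this.congr fun t => ?_
    rw [one_div_mul_eq_div, div_eq_mul_inv, one_div, mul_inv, mul_comm]
  have hlim1 : ∀ x : ℝ, Tendsto (fun t : ℝ => jacobiTheta₂ x (-1 / ((c : ℂ) ^ 2 * (I * t))))
      (𝓝[>] 0) (𝓝 1) := by
    intro x
    refine (tendsto_jacobiTheta₂_ofReal_im_atTop x).comp (tendsto_comap_iff.mpr ?_)
    refine htop.congr' ?_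
    filter_upwards [self_mem_nhdsWithin] with t ht
    simp only [Function.comp_apply]
    rw [hinv' t ht, im_ofReal_mul, I_im, mul_one]
  have hlim2 : ∀ x : ℝ, Tendsto
      (fun t : ℝ => jacobiTheta₂ x (-1 / ((a : ℂ) ^ 2 * (I * t * v t)))) (𝓝[>] 0) (𝓝 1) := by
    intro x
    refine (tendsto_jacobiTheta₂_ofReal_im_atTop x).comp (tendsto_comap_iff.mpr ?_)
    refine htop.congr' ?_
    filter_upwards [self_mem_nhdsWithin] with t ht
    simp only [Function.comp_apply]
    rw [hinv t ht, add_im, ofReal_im, zero_add, im_ofReal_mul, I_im, mul_one]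
  have hid : ∀ t : ℝ, 0 < t →
      (1 / c : ℂ) * ∑ r ∈ Finset.range c, cexp (Real.pi * I * a * r ^ 2 / c) *
        jacobiTheta₂ ((r / c : ℝ) : ℂ) (-1 / ((c : ℂ) ^ 2 * (I * t))) =
      1 / (-I * (a / c + I * t)) ^ (1 / 2 : ℂ) * ((1 / (a * (v t) ^ (1 / 2 : ℂ))) *
        ∑ r ∈ Finset.range a, cexp (-(Real.pi * I * c * r ^ 2 / a)) *
          jacobiTheta₂ ((r / a : ℝ) : ℂ) (-1 / ((a : ℂ) ^ 2 * (I * t * v t)))) := by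
    intro t ht
    have ht0 : (t : ℂ) ≠ 0 := by exact_mod_cast ht.ne'
    have hs : 0 < √t := Real.sqrt_pos.mpr ht
    have hs0 : ((√t : ℝ) : ℂ) ≠ 0 := by exact_mod_cast hs.ne'
    have hsq : ((√t : ℝ) : ℂ) ^ 2 = t := by exact_mod_cast Real.sq_sqrt ht.le
    have him : 0 < (I * t : ℂ).im := by simpa using ht
    have hwim : 0 < (I * t * v t : ℂ).im := by
      have h : 0 < (-1 / ((a : ℂ) ^ 2 * (I * t * v t))).im := by
        rw [hinv t ht, add_im, ofReal_im, zero_add, im_ofReal_mul, I_im, mul_one]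
        positivity
      have e : (I * t * v t : ℂ) =
          ((1 / a ^ 2 : ℝ) : ℂ) * -(-1 / ((a : ℂ) ^ 2 * (I * t * v t)))⁻¹ := by
        have : (I * t * v t : ℂ) ≠ 0 := by
          intro h0
          rw [h0] at h
          simp at h
        push_cast
        field_simp
      rw [e, im_ofReal_mul, neg_im, inv_im]
      have hn : 0 < normSq (-1 / ((a : ℂ) ^ 2 * (I * t * v t))) := by
        rw [normSq_pos]
        intro h0
        rw [h0] at h
        simp at h
      have := div_pos h hn
      have ha2 : (0 : ℝ) < 1 / a ^ 2 := by positivity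
      rw [neg_div, neg_neg]
      exact mul_pos ha2 this
    have h1 := jacobiTheta₂_zero_rat_add (a := a) hc (by exact_mod_cast hac) him
    have h2 := jacobiTheta₂_zero_rat_add (a := -c) (c := a) ha
      (by rw [neg_mul, even_neg, mul_comm]; exact_mod_cast hac) hwim
    have hτ : -1 / ((a : ℂ) / c + I * t) = ((-c : ℤ) : ℂ) / a + I * t * v t := by
      have := hden t
      have h3 : (a : ℂ) / c + I * t = (a + I * t * c) / c := by field_simp
      rw [h3]
      simp only [hv]
      push_cast
      field_simp
      ring
    have h3 := jacobiTheta₂_functional_equation 0 ((a : ℂ) / c + I * t)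
    rw [zero_div, hτ, h2] at h3
    push_cast at h1 h3
    rw [h1] at h3
    have e1 : (-I * (I * t)) ^ (1 / 2 : ℂ) = √t := by
      rw [show -I * (I * t) = ((√t : ℝ) : ℂ) ^ 2 * 1 by
        rw [hsq]; linear_combination (-t : ℂ) * I_sq, sq_mul_cpow_half hs]
      simp
    have e2 : (-I * (I * t * v t)) ^ (1 / 2 : ℂ) = √t * (v t) ^ (1 / 2 : ℂ) := by
      rw [← sq_mul_cpow_half hs]
      congr 1
      rw [hsq]; linear_combination (-t * v t : ℂ) * I_sq
    rw [e1, e2] at h3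
    have h4 := congrArg (fun z => (√t : ℂ) * z) h3
    simp only [zero_pow two_ne_zero, mul_zero, zero_div, Complex.exp_zero, mul_one] at h4
    have e3 : ∀ r : ℕ, cexp (Real.pi * I * -c * r ^ 2 / a) =
        cexp (-(Real.pi * I * c * r ^ 2 / a)) := fun r => by congr 1; ring
    simp only [e3] at h4
    push_cast
    convert! h4 using 1
    · field_simp
    · field_simp
  have hL : Tendsto (fun t : ℝ => (1 / c : ℂ) * ∑ r ∈ Finset.range c,
      cexp (Real.pi * I * a * r ^ 2 / c) *
        jacobiTheta₂ ((r / c : ℝ) : ℂ) (-1 / ((c : ℂ) ^ 2 * (I * t)))) (𝓝[>] 0)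
      (𝓝 ((1 / c : ℂ) * ∑ r ∈ Finset.range c, cexp (Real.pi * I * a * r ^ 2 / c) * 1)) :=
    (tendsto_finsetSum _ fun r _ => (hlim1 _).const_mul _).const_mul _
  have hvhalf : Tendsto (fun t => (v t) ^ (1 / 2 : ℂ)) (𝓝[>] 0) (𝓝 ((c / a : ℝ) : ℂ)) := by
    have hpos : (0 : ℝ) < c / a := by positivity
    have := hvt.cpow (tendsto_const_nhds (x := (1 / 2 : ℂ))) (by
      rw [mul_one, ← ofReal_pow]
      exact ofReal_mem_slitPlane.mpr (by positivity))
    rwa [sq_mul_cpow_half hpos, one_cpow, mul_one] at this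
  have hpre : Tendsto (fun t : ℝ => (-I * (a / c + I * t)) ^ (1 / 2 : ℂ)) (𝓝[>] 0)
      (𝓝 ((-I * (a / c)) ^ (1 / 2 : ℂ))) := by
    have hz : Tendsto (fun t : ℝ => (-I * (a / c + I * t))) (𝓝[>] 0) (𝓝 (-I * (a / c))) := by
      have : Continuous (fun t : ℝ => (-I * (a / c + I * t))) := by fun_prop
      simpa using (this.tendsto 0).mono_left (nhdsWithin_le_nhds (s := Set.Ioi 0))
    refine hz.cpow tendsto_const_nhds ?_
    right
    rw [show (-I * (a / c) : ℂ) = ((a / c : ℝ) : ℂ) * (-I) by push_cast; ring, im_ofReal_mul]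
    simp [ha.ne', hc.ne']
  have hbase : (-I * (a / c) : ℂ) ^ (1 / 2 : ℂ) ≠ 0 := by
    rw [Ne, cpow_eq_zero_iff]
    simp [ha0, hc0]
  have hca : (((c / a : ℝ) : ℝ) : ℂ) ≠ 0 := by
    push_cast
    exact div_ne_zero hc0 ha0
  have hR := ((tendsto_const_nhds (x := (1 : ℂ))).div hpre hbase).mul
    (((tendsto_const_nhds (x := (1 : ℂ))).div (hvhalf.const_mul (a : ℂ))
      (mul_ne_zero ha0 hca)).mul
    (tendsto_finsetSum (Finset.range a) fun r _ =>
      (hlim2 (r / a)).const_mul (cexp (-(Real.pi * I * c * r ^ 2 / a)))))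
  have hfin := tendsto_nhds_unique (hL.congr' (by
    filter_upwards [self_mem_nhdsWithin] with t ht using hid t ht)) hR
  simp only [mul_one] at hfin
  have hca' : (a : ℂ) * ((c / a : ℝ) : ℂ) = c := by
    push_cast
    field_simp
  rw [hca'] at hfin
  have := congrArg (fun z => (c : ℂ) * z) hfin
  rw [← mul_assoc, mul_one_div_cancel hc0, one_mul] at this
  rw [this]
  field_simp

theorem sum_range_add_int_of_periodic {f : ℤ → ℂ} {c : ℕ} (hf : Function.Periodic f c) (k : ℤ) :
    ∑ l ∈ Finset.range c, f (l + k) = ∑ l ∈ Finset.range c, f l := by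
  have step : ∀ k : ℤ, ∑ l ∈ Finset.range c, f (l + (k + 1)) =
      ∑ l ∈ Finset.range c, f (l + k) := by
    intro k
    have h1 := Finset.sum_range_succ (fun l : ℕ => f (l + k)) c
    rw [Finset.sum_range_succ'] at h1
    have h2 : f ((c : ℤ) + k) = f (((0 : ℕ) : ℤ) + k) := by
      rw [add_comm, hf, Nat.cast_zero, zero_add]
    rw [h2] at h1
    rw [← add_right_cancel h1]
    refine Finset.sum_congr rfl fun l _ => ?_
    congr 1
    push_cast
    ring
  induction k using Int.induction_on with
  | zero => simp
  | succ i ih => rw [step, ih]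
  | pred i ih => rw [← step, sub_add_cancel, ih]

theorem exp_two_pi_mul_I_mul_div_congr {c : ℕ} (hc : 0 < c) {x y : ℤ} (h : x ≡ y [ZMOD c]) :
    cexp (2 * Real.pi * I * x / c) = cexp (2 * Real.pi * I * y / c) := by
  have hc0 : (c : ℂ) ≠ 0 := by exact_mod_cast hc.ne'
  obtain ⟨k, hk⟩ := h.symm.dvd
  have hk' : (x : ℂ) = y + c * k := by
    have : x = y + c * k := by linarith
    exact_mod_cast this
  rw [Complex.exp_eq_exp_iff_exists_int]
  refine ⟨k, ?_⟩
  rw [hk']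
  field_simp

theorem gaussG_eq_sum (a b : ℤ) (c : ℕ) :
    gaussG a b c = ∑ l ∈ Finset.range c,
      cexp (2 * Real.pi * I * ((a * (l : ℤ) ^ 2 + b * (l : ℤ) : ℤ) : ℂ) / c) := by
  simp [gaussG]

theorem gaussG_congr_left {a a' : ℤ} {c : ℕ} (hc : 0 < c) (h : a ≡ a' [ZMOD c]) (b : ℤ) :
    gaussG a b c = gaussG a' b c := by
  rw [gaussG_eq_sum, gaussG_eq_sum]
  exact Finset.sum_congr rfl fun l _ =>
    exp_two_pi_mul_I_mul_div_congr hc ((h.mul_right _).add_right _)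

theorem gaussG_neg_zero (a : ℤ) (c : ℕ) :
    gaussG (-a) 0 c = (starRingEnd ℂ) (gaussG a 0 c) := by
  simp only [gaussG, map_sum, ← Complex.exp_conj]
  refine Finset.sum_congr rfl fun l _ => ?_
  congr 1
  simp [Complex.conj_ofNat]

/-- Completing the square in a quadratic Gauss sum. -/
theorem gaussG_neg_eq_mul {p m φ : ℤ} {q : ℕ} (hq : 0 < q) (hφ : 4 * p * φ ≡ 1 [ZMOD q]) :
    gaussG (-p) m q =
      gaussG (-p) 0 q * cexp (2 * Real.pi * I * φ * (m : ℂ) ^ 2 / q) := by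
  have hper : Function.Periodic
      (fun l : ℤ => cexp (2 * Real.pi * I * ((-p * l ^ 2 + m * l : ℤ) : ℂ) / q)) (q : ℤ) := by
    intro l
    refine exp_two_pi_mul_I_mul_div_congr hq ?_
    have h : l + q ≡ l [ZMOD q] := by simp
    exact ((h.pow 2).mul_left _).add (h.mul_left _)
  rw [gaussG_eq_sum, gaussG_eq_sum, ← sum_range_add_int_of_periodic hper (2 * φ * m),
    Finset.sum_mul]
  refine Finset.sum_congr rfl fun l _ => ?_
  have h : -p * ((l : ℤ) + 2 * φ * m) ^ 2 + m * (l + 2 * φ * m) ≡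
      -p * (l : ℤ) ^ 2 + 0 * l + φ * m ^ 2 [ZMOD q] := by
    obtain ⟨k, hk⟩ := hφ.dvd
    refine (Int.modEq_iff_dvd).mpr ⟨-k * (m * l + φ * m ^ 2), ?_⟩
    linear_combination (-(m * l + φ * m ^ 2)) * hk
  rw [exp_two_pi_mul_I_mul_div_congr hq h, ← Complex.exp_add]
  congr 1
  push_cast
  ring

theorem sum_range_two_mul {M : Type*} [AddCommMonoid M] (f : ℕ → M) (n : ℕ) :
    ∑ r ∈ Finset.range (2 * n), f r =
      ∑ r ∈ Finset.range n, f (2 * r) + ∑ r ∈ Finset.range n, f (2 * r + 1) := by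
  induction n with
  | zero => simp
  | succ n ih =>
    rw [show 2 * (n + 1) = 2 * n + 1 + 1 by ring, Finset.sum_range_succ, Finset.sum_range_succ, ih,
      Finset.sum_range_succ, Finset.sum_range_succ]
    abel

theorem sum_range_exp_neg_eq_gaussG {a : ℕ} (ha : Odd a) (q : ℕ) :
    ∑ r ∈ Finset.range (2 * a), cexp (-(Real.pi * I * q * r ^ 2 / (2 * a : ℕ))) =
      (1 + (-I) ^ (q * a)) * gaussG (-q) 0 a := by
  obtain ⟨b, hb⟩ := ha
  have ha0 : 0 < a := by omega
  have ha0' : (a : ℂ) ≠ 0 := by exact_mod_cast ha0.ne'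
  have hab : (a : ℂ) = 2 * b + 1 := by exact_mod_cast hb
  rw [sum_range_two_mul, add_mul, one_mul]
  congr 1
  · rw [gaussG_eq_sum]
    refine Finset.sum_congr rfl fun l _ => ?_
    congr 1
    push_cast
    field_simp
    ring
  · have hper : Function.Periodic
        (fun u : ℤ => cexp (-(Real.pi * I * q * (2 * u + 1) ^ 2 / (2 * a : ℕ)))) (a : ℤ) := by
      intro u
      simp only
      rw [Complex.exp_eq_exp_iff_exists_int]
      refine ⟨-(q * (2 * u + 1 + a)), ?_⟩
      push_cast
      field_simp
      ring
    have h := sum_range_add_int_of_periodic hper b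
    push_cast at h ⊢
    rw [← h, gaussG_eq_sum, Finset.mul_sum]
    refine Finset.sum_congr rfl fun u _ => ?_
    have hI : (-I) ^ (q * a) = cexp (-(Real.pi * I * q * a / 2)) := by
      have : cexp (-(Real.pi / 2 * I)) = -I := by
        rw [← neg_mul, Complex.exp_mul_I, Complex.cos_neg, Complex.sin_neg,
          Complex.cos_pi_div_two, Complex.sin_pi_div_two]
        ring
      rw [← this, ← Complex.exp_nat_mul]
      congr 1
      push_cast
      ring
    rw [hI, ← Complex.exp_add, Complex.exp_eq_exp_iff_exists_int]
    refine ⟨-(q * u), ?_⟩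
    have hb' : (b : ℂ) = (a - 1) / 2 := by rw [hab]; ring
    push_cast
    rw [hb']
    field_simp
    ring

/-- Reciprocity for quadratic Gauss sums with odd parameters. -/
theorem gaussG_reciprocity {a q : ℕ} (ha : Odd a) (hq : 0 < q) :
    gaussG a 0 q =
      √(q / a : ℝ) * ((1 + I) / 2 * (1 + (-I) ^ (q * a))) * gaussG (-q) 0 a := by
  have ha0 : 0 < a := ha.pos
  have ha0' : (0 : ℝ) < a := by exact_mod_cast ha0
  have hq0' : (0 : ℝ) < q := by exact_mod_cast hq
  have h := landsberg_schaar (a := 2 * a) (c := q) (by omega) hq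
    (by rw [mul_assoc]; exact even_two_mul _)
  rw [sum_range_exp_neg_eq_gaussG ha] at h
  have hs : 0 < √(a / q : ℝ) := Real.sqrt_pos.mpr (by positivity)
  have hroot : (-I * ((2 * a : ℕ) / q)) ^ (1 / 2 : ℂ) = √(a / q : ℝ) * (1 - I) := by
    have e : -I * ((2 * a : ℕ) / q : ℂ) = ((√(a / q : ℝ) : ℝ) : ℂ) ^ 2 * (1 - I) ^ 2 := by
      rw [← ofReal_pow, Real.sq_sqrt (by positivity)]
      push_cast
      linear_combination (-(a / q : ℂ)) * I_sq
    rw [e, sq_mul_cpow_half hs, one_div, sq_cpow_two_inv (by simp)]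
  have hinv : (√(q / a : ℝ) : ℂ) * √(a / q : ℝ) = 1 := by
    rw [← ofReal_mul, ← Real.sqrt_mul (by positivity)]
    have : (q / a * (a / q) : ℝ) = 1 := by field_simp
    rw [this]
    simp
  have hI : (1 - I) ≠ 0 := fun h => by simpa using congrArg re h
  have hs0 : (√(a / q : ℝ) : ℂ) ≠ 0 := by exact_mod_cast hs.ne'
  have hpre : 1 / (√(a / q : ℝ) * (1 - I)) = (√(q / a : ℝ) : ℂ) * ((1 + I) / 2) := by
    rw [div_eq_iff (mul_ne_zero hs0 hI)]
    linear_combination -((1 - I) * (1 + I) / 2) * hinv + I_sq / 2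
  rw [hroot, hpre] at h
  have hl : gaussG a 0 q = ∑ r ∈ Finset.range q, cexp (Real.pi * I * (2 * a : ℕ) * r ^ 2 / q) := by
    rw [gaussG_eq_sum]
    refine Finset.sum_congr rfl fun l _ => ?_
    congr 1
    push_cast
    ring
  rw [hl, h]
  ring

/-- The sign `ε_q` of quadratic Gauss sums, equal to `1` or `I` according to `q` modulo `4`. -/
noncomputable def gaussSign (q : ℕ) : ℂ := if q % 4 = 1 then 1 else I

theorem gaussSign_mul_eq {n : ℕ} (hn : Odd n) :
    (1 + I) / 2 * (1 + (-I) ^ n) = gaussSign n := by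
  have h4 : (-I) ^ 4 = 1 := by rw [neg_pow, I_pow_four]; norm_num
  have hd := Nat.div_add_mod n 4
  have hpow : (-I) ^ n = (-I) ^ (n % 4) := by
    conv_lhs => rw [← hd]
    rw [pow_add, pow_mul, h4, one_pow, one_mul]
  rw [hpow, gaussSign]
  rcases Nat.odd_mod_four_iff.mp (Nat.odd_iff.mp hn) with h | h
  · rw [if_pos h, h]
    linear_combination (-1 / 2 : ℂ) * I_sq
  · rw [if_neg (by omega), h]
    linear_combination (1 - I - I ^ 2) / 2 * I_sq

open NumberTheorySymbols in
theorem gaussSign_mul_jacobiSym {a q : ℕ} (ha : Odd a) (hq : Odd q) :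
    gaussSign (q * a) * (gaussSign a * (J(-q | a) : ℂ)) = gaussSign q * (J(a | q) : ℂ) := by
  have hmod := Nat.mul_mod q a 4
  rw [jacobiSym.neg _ ha]
  unfold gaussSign
  rcases Nat.odd_mod_four_iff.mp (Nat.odd_iff.mp ha) with h | h
  · rw [jacobiSym.quadratic_reciprocity_one_mod_four h hq, ZMod.χ₄_nat_one_mod_four h]
    rcases Nat.odd_mod_four_iff.mp (Nat.odd_iff.mp hq) with h' | h' <;>
    · rw [h, h'] at hmod
      simp [hmod, h, h']
  · rw [ZMod.χ₄_nat_three_mod_four h]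
    rcases Nat.odd_mod_four_iff.mp (Nat.odd_iff.mp hq) with h' | h'
    · rw [jacobiSym.quadratic_reciprocity_one_mod_four' ha h']
      rw [h, h'] at hmod
      simp [hmod, h, h', ← mul_assoc]
    · rw [jacobiSym.quadratic_reciprocity_three_mod_four h h']
      rw [h, h'] at hmod
      simp [hmod, h, h']

theorem conj_gaussSign {q : ℕ} (hq : Odd q) :
    (starRingEnd ℂ) (gaussSign q) = (ZMod.χ₄ q : ℤ) * gaussSign q := by
  unfold gaussSign
  rcases Nat.odd_mod_four_iff.mp (Nat.odd_iff.mp hq) with h | h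
  · simp [h, ZMod.χ₄_nat_one_mod_four h]
  · simp [h, ZMod.χ₄_nat_three_mod_four h]

open NumberTheorySymbols in
/-- The value of the quadratic Gauss sum modulo an odd number. -/
theorem gaussG_zero_eq {q : ℕ} (hq : Odd q) {a : ℤ} (haq : IsCoprime a q) :
    gaussG a 0 q = √(q : ℝ) * (gaussSign q * (J(a | q) : ℂ)) := by
  induction q using Nat.strong_induction_on generalizing a with
  | _ q ih =>
  have hq0 : 0 < q := hq.pos
  have hodd : ∀ b : ℕ, Odd b → b < q → IsCoprime (b : ℤ) q →
      gaussG b 0 q = √(q : ℝ) * (gaussSign q * (J(b | q) : ℂ)) := by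
    intro b hb hbq hcop
    have hb0 : (b : ℝ) ≠ 0 := by exact_mod_cast hb.pos.ne'
    rw [gaussG_reciprocity hb hq0, gaussSign_mul_eq (hq.mul hb), ih b hbq hb hcop.symm.neg_left,
      ← gaussSign_mul_jacobiSym hb hq]
    have : √(q / b : ℝ) * √(b : ℝ) = √(q : ℝ) := by
      rw [← Real.sqrt_mul (by positivity), div_mul_cancel₀ _ hb0]
    rw [← this]
    push_cast
    ring
  rcases (show 1 ≤ q from hq0).eq_or_lt with rfl | hq1
  · simp [gaussG, gaussSign]
  have hq0' : (0 : ℤ) < q := by exact_mod_cast hq0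
  obtain ⟨r, hr⟩ := Int.eq_ofNat_of_zero_le (Int.emod_nonneg a hq0'.ne')
  have hrq : r < q := by
    have := Int.emod_lt_of_pos a hq0'
    omega
  have har : a ≡ r [ZMOD q] := by rw [← hr]; exact (Int.mod_modEq a q).symm
  have hrc : IsCoprime (r : ℤ) q := by
    obtain ⟨k, hk⟩ := har.dvd
    rw [eq_add_of_sub_eq' hk]
    exact haq.add_mul_left_left k
  rw [gaussG_congr_left hq0 har, jacobiSym.mod_left' har]
  rcases Nat.even_or_odd r with he | ho
  · have hr0 : r ≠ 0 := by
      rintro rfl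
      rw [Nat.cast_zero, isCoprime_zero_left, Int.isUnit_iff] at hrc
      omega
    have hs : Odd (q - r) := Nat.Odd.sub_even hrq.le hq he
    have hcast : ((q - r : ℕ) : ℤ) = q - r := by omega
    have hrs : (r : ℤ) ≡ -((q - r : ℕ) : ℤ) [ZMOD q] := by
      rw [hcast]
      exact Int.modEq_iff_dvd.mpr ⟨-1, by ring⟩
    have hsc : IsCoprime ((q - r : ℕ) : ℤ) q := by
      rw [hcast, sub_eq_neg_add]
      simpa using hrc.neg_left.add_mul_left_left 1
    rw [gaussG_congr_left hq0 hrs, jacobiSym.mod_left' hrs, gaussG_neg_zero,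
      hodd _ hs (by omega) hsc, jacobiSym.neg _ hq, map_mul, map_mul, conj_gaussSign hq]
    simp only [conj_ofReal, map_intCast]
    push_cast
    ring
  · exact hodd r ho hrq hrc

theorem stmt_1 (p q : ℕ) (hp : 0 < p) (hq : 0 < q) (hpq : Nat.Coprime p q)
    (hq4 : q % 4 = 1) (m φ : ℤ) (hφ : 4 * (p : ℤ) * φ ≡ 1 [ZMOD (q : ℤ)]) :
    gaussG (-(p : ℤ)) m q =
      (Real.sqrt q : ℂ) * (jacobiSym (p : ℤ) q : ℂ) *
        Complex.exp (2 * (Real.pi : ℂ) * Complex.I * (φ : ℂ) * (m : ℂ) ^ 2 / (q : ℂ)) := by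
  have hodd : Odd q := Nat.odd_iff.mpr (Nat.odd_of_mod_four_eq_one hq4)
  rw [gaussG_neg_eq_mul hq hφ,
    gaussG_zero_eq hodd (Nat.isCoprime_iff_coprime.mpr hpq).neg_left, jacobiSym.neg _ hodd,
    ZMod.χ₄_nat_one_mod_four hq4, gaussSign, if_pos hq4, one_mul, one_mul]
end

section
/- Let p and q be coprime positive integers with q odd, let m be an integer, and let φ be an integer with 4p·φ ≡ 1 (mod q). Then G(-p, m+1, q) · conj(G(-p, m, q)) = q · exp(2πi φ (2m+1)/q). -/
/-- A generalized quadratic Gauss sum is a sum of additive character values over `ZMod c`. -/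
theorem gaussG_eq_sum_stdAddChar (a b : ℤ) (c : ℕ) [NeZero c] :
    gaussG a b c = ∑ x : ZMod c, ZMod.stdAddChar ((a : ZMod c) * x ^ 2 + (b : ZMod c) * x) := by
  unfold gaussG
  refine Finset.sum_bij' (fun l _ => (l : ZMod c)) (fun x _ => x.val) (fun _ _ => Finset.mem_univ _)
    (fun x _ => Finset.mem_range.2 x.val_lt)
    (fun l hl => ZMod.val_cast_of_lt (Finset.mem_range.1 hl)) (fun x _ => ZMod.natCast_zmod_val x) ?_
  intro l _
  have h := ZMod.stdAddChar_coe (N := c) (a * (l : ℤ) ^ 2 + b * (l : ℤ))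
  push_cast at h
  exact h.symm

/-- Completing the square in a quadratic exponential sum. -/
theorem sum_addChar_complete_square {R : Type*} [CommRing R] [Fintype R] (ψ : AddChar R ℂ)
    {a f : R} (h : 4 * a * f = 1) (b : R) :
    ∑ x, ψ (-a * x ^ 2 + b * x) = ψ (f * b ^ 2) * ∑ x, ψ (-a * x ^ 2) := by
  rw [← Equiv.sum_comp (Equiv.addRight (2 * f * b)), Finset.mul_sum]
  refine Finset.sum_congr rfl fun x _ => ?_
  rw [← AddChar.map_add_eq_mul, Equiv.coe_addRight]
  congr 1
  linear_combination (-b * x - f * b ^ 2) * h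

/-- The squared modulus of a nondegenerate quadratic exponential sum. -/
theorem sum_addChar_sq_mul_conj {R : Type*} [CommRing R] [Fintype R] {ψ : AddChar R ℂ}
    (hψ : ψ.IsPrimitive) {a : R} (ha : IsUnit (2 * a)) :
    (∑ x, ψ (a * x ^ 2)) * (starRingEnd ℂ) (∑ x, ψ (a * x ^ 2)) = Fintype.card R := by
  classical
  calc
    _ = ∑ y, ∑ x, ψ (a * x ^ 2 - a * y ^ 2) := by
      rw [map_sum, Finset.sum_mul_sum, Finset.sum_comm]
      simp_rw [← AddChar.map_neg_eq_conj, ← AddChar.map_add_eq_mul,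
        ← sub_eq_add_neg]
    _ = ∑ y, ∑ t, ψ (a * t ^ 2) * ψ (y * (2 * a * t)) := by
      refine Finset.sum_congr rfl fun y _ => ?_
      rw [← Equiv.sum_comp (Equiv.addRight y)]
      refine Finset.sum_congr rfl fun t _ => ?_
      rw [← AddChar.map_add_eq_mul, Equiv.coe_addRight]
      congr 1
      ring
    _ = ∑ t, ψ (a * t ^ 2) * if t = 0 then (Fintype.card R : ℂ) else 0 := by
      rw [Finset.sum_comm]
      refine Finset.sum_congr rfl fun t _ => ?_
      rw [← Finset.mul_sum, AddChar.sum_mulShift _ hψ]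
      simp [ha.mul_right_eq_zero]
    _ = _ := by simp

theorem stmt_3 (p q : ℕ) (hp : 0 < p) (hq : 0 < q) (hpq : Nat.Coprime p q)
    (hqodd : Odd q) (m φ : ℤ) (hφ : 4 * (p : ℤ) * φ ≡ 1 [ZMOD (q : ℤ)]) :
    gaussG (-(p : ℤ)) (m + 1) q * (starRingEnd ℂ) (gaussG (-(p : ℤ)) m q) =
      (q : ℂ) *
        Complex.exp (2 * (Real.pi : ℂ) * Complex.I * (φ : ℂ) * (2 * (m : ℂ) + 1) / (q : ℂ)) := by
  have : NeZero q := ⟨hq.ne'⟩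
  have h : 4 * (p : ZMod q) * (φ : ZMod q) = 1 := by
    have := (ZMod.intCast_eq_intCast_iff _ _ q).2 hφ
    push_cast at this
    exact this
  have hu : IsUnit (2 * -(p : ZMod q)) :=
    .of_mul_eq_one (-2 * (φ : ZMod q)) (by linear_combination h)
  have hS := sum_addChar_sq_mul_conj (ZMod.isPrimitive_stdAddChar q) hu
  rw [ZMod.card] at hS
  have hexp : Complex.exp (2 * (Real.pi : ℂ) * Complex.I * (φ : ℂ) * (2 * (m : ℂ) + 1) / (q : ℂ)) =
      ZMod.stdAddChar ((φ : ZMod q) * (2 * (m : ZMod q) + 1)) := by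
    have h' := ZMod.stdAddChar_coe (N := q) (φ * (2 * m + 1))
    push_cast at h'
    rw [h', mul_assoc _ (φ : ℂ)]
  have hψ : ZMod.stdAddChar ((φ : ZMod q) * (2 * (m : ZMod q) + 1)) =
      ZMod.stdAddChar ((φ : ZMod q) * ((m : ZMod q) + 1) ^ 2) *
        (starRingEnd ℂ) (ZMod.stdAddChar ((φ : ZMod q) * (m : ZMod q) ^ 2)) := by
    rw [← AddChar.map_neg_eq_conj, ← AddChar.map_add_eq_mul]
    congr 1
    ring
  simp only [gaussG_eq_sum_stdAddChar, Int.cast_neg, Int.cast_natCast, Int.cast_add, Int.cast_one,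
    sum_addChar_complete_square _ h, map_mul, hexp, hψ]
  rw [mul_mul_mul_comm, hS, mul_comm]
end

section
/- Let ρ, θ, θ' be real numbers. Then the determinant of the 3×3 real matrix whose first row is (1,0,0), whose second row is the first row of M(ρ,θ), and whose third row is the first row of M(ρ,θ')·M(ρ,θ), equals sin²ρ · sin(θ' − θ). -/
open Real

/-- The rotation matrix `M(ρ,θ)` induced by a Dirac delta `ρ e^{iθ} δ` on the frame
`(T, e₁, e₂)`. -/
noncomputable def rotM (ρ θ : ℝ) : Matrix (Fin 3) (Fin 3) ℝ :=
  !![cos ρ, sin ρ * cos θ, sin ρ * sin θ;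
     -(sin ρ * cos θ), cos ρ * cos θ ^ 2 + sin θ ^ 2, (cos ρ - 1) * cos θ * sin θ;
     -(sin ρ * sin θ), (cos ρ - 1) * cos θ * sin θ, cos ρ * sin θ ^ 2 + cos θ ^ 2]

theorem stmt_11 (ρ θ θ' : ℝ) :
    (Matrix.of ![![(1 : ℝ), 0, 0], rotM ρ θ 0, (rotM ρ θ' * rotM ρ θ) 0]).det =
      sin ρ ^ 2 * sin (θ' - θ) := by
  rw [sin_sub]
  simp [Matrix.det_fin_three, rotM]
  linear_combination
    sin ρ ^ 2 * (sin θ' * cos θ - cos θ' * sin θ) * sin_sq_add_cos_sq θ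
end

section
/- Let ω ≥ 5, set q = 2^ω, and let a, b be integers with a ≡ 2 (mod 4) and b odd. Then for every n, the residue (an + b) mod q is odd (hence a unit of ℤ/qℤ), and the map from {0, 1, …, 2^{ω−1} − 1} to the group of units of ℤ/qℤ sending n to the multiplicative inverse of (an + b) mod q is a bijection. Consequently, the sequence x_n ≡ (an + b)^{−1} (mod 2^ω) is periodic with period 2^{ω−1} and {x_0, …, x_{2^{ω−1}−1}} is exactly the set of odd residues modulo 2^ω. -/
theorem isUnit_intCast_zmod_two_pow_iff_odd (k : ℕ) (z : ℤ) :
    IsUnit (z : ZMod (2 ^ (k + 1))) ↔ Odd z := by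
  rw [ZMod.coe_int_isUnit_iff_isCoprime, Nat.cast_pow, IsCoprime.pow_left_iff k.succ_pos,
    Nat.cast_ofNat, Int.isCoprime_two_left]

theorem isUnit_zmod_two_pow_iff_odd_val (k : ℕ) (z : ZMod (2 ^ (k + 1))) :
    IsUnit z ↔ Odd z.val := by
  have h := isUnit_intCast_zmod_two_pow_iff_odd k (z.val : ℤ)
  rwa [Int.cast_natCast, ZMod.natCast_zmod_val, Int.odd_coe_nat] at h

theorem isUnit_zmod_inv {m : ℕ} {z : ZMod m} (hz : IsUnit z) : IsUnit z⁻¹ :=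
  .of_mul_eq_one z (ZMod.inv_mul_of_unit z hz)

theorem zmod_inv_inv_of_isUnit {m : ℕ} {z : ZMod m} (hz : IsUnit z) : z⁻¹⁻¹ = z := by
  calc z⁻¹⁻¹ = z * z⁻¹ * z⁻¹⁻¹ := by rw [ZMod.mul_inv_of_unit z hz, one_mul]
    _ = z := by rw [mul_assoc, ZMod.mul_inv_of_unit _ (isUnit_zmod_inv hz), mul_one]

theorem intCast_two_mul_odd_eq_iff (k : ℕ) {c : ℤ} (hc : Odd c) (b x y : ℤ) :
    ((2 * c * x + b : ℤ) : ZMod (2 ^ (k + 1))) = ((2 * c * y + b : ℤ) : ZMod (2 ^ (k + 1))) ↔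
      (2 : ℤ) ^ k ∣ y - x := by
  have hcop : IsCoprime ((2 : ℤ) ^ k) c := (Int.isCoprime_two_left.2 hc).pow_left
  rw [ZMod.intCast_eq_intCast_iff_dvd_sub, Nat.cast_pow, Nat.cast_ofNat,
    show 2 * c * y + b - (2 * c * x + b) = 2 * (c * (y - x)) by ring, pow_succ',
    mul_dvd_mul_iff_left two_ne_zero]
  exact ⟨hcop.dvd_of_dvd_mul_left, fun h => h.mul_left c⟩

theorem exists_lt_intCast_two_mul_odd_eq (k : ℕ) {c b w : ℤ} (hc : Odd c) (hb : Odd b)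
    (hw : Odd w) :
    ∃ n : ℕ, n < 2 ^ k ∧ ((2 * c * n + b : ℤ) : ZMod (2 ^ (k + 1))) = w := by
  obtain ⟨d, hd⟩ := (hw.sub_odd hb).two_dvd
  obtain ⟨u, v, huv⟩ : IsCoprime ((2 : ℤ) ^ k) c := (Int.isCoprime_two_left.2 hc).pow_left
  have hpos : (0 : ℤ) < 2 ^ k := by positivity
  have hnn := Int.emod_nonneg (v * d) hpos.ne'
  have hlt := Int.emod_lt_of_pos (v * d) hpos
  refine ⟨((v * d) % 2 ^ k).toNat, by zify; rwa [Int.toNat_of_nonneg hnn], ?_⟩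
  rw [Int.toNat_of_nonneg hnn, (intCast_two_mul_odd_eq_iff k hc b _ (v * d)).2
    Int.dvd_self_sub_emod, ZMod.intCast_eq_intCast_iff_dvd_sub]
  refine ⟨u * d, ?_⟩
  push_cast
  linear_combination hd - 2 * d * huv

theorem stmt_17 (ω : ℕ) (hω : 5 ≤ ω) (a b : ℤ)
    (ha : a ≡ 2 [ZMOD 4]) (hb : Odd b) :
    (∀ n : ℕ, Odd (((a * n + b : ℤ) : ZMod (2 ^ ω)).val) ∧
        IsUnit ((a * n + b : ℤ) : ZMod (2 ^ ω))) ∧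
      Function.Injective
        (fun n : Fin (2 ^ (ω - 1)) => ((a * (n : ℕ) + b : ℤ) : ZMod (2 ^ ω))⁻¹) ∧
      Set.range (fun n : Fin (2 ^ (ω - 1)) => ((a * (n : ℕ) + b : ℤ) : ZMod (2 ^ ω))⁻¹) =
        {z : ZMod (2 ^ ω) | Odd z.val} ∧
      ∀ n : ℕ, ((a * (n + 2 ^ (ω - 1)) + b : ℤ) : ZMod (2 ^ ω))⁻¹ =
        ((a * n + b : ℤ) : ZMod (2 ^ ω))⁻¹ := by
  obtain ⟨k, rfl⟩ : ∃ k, ω = k + 1 := ⟨ω - 1, by omega⟩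
  obtain ⟨c, rfl, hc⟩ : ∃ c, a = 2 * c ∧ Odd c := by
    refine ⟨a / 2, ?_, ?_⟩
    · unfold Int.ModEq at ha; omega
    · rw [Int.odd_iff]; unfold Int.ModEq at ha; omega
  rw [Nat.add_sub_cancel]
  have hunit (n : ℕ) : IsUnit ((2 * c * n + b : ℤ) : ZMod (2 ^ (k + 1))) := by
    rw [isUnit_intCast_zmod_two_pow_iff_odd, mul_assoc]
    exact (even_two_mul _).add_odd hb
  refine ⟨fun n => ⟨(isUnit_zmod_two_pow_iff_odd_val k _).1 (hunit n), hunit n⟩, ?_, ?_, ?_⟩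
  · intro m n hmn
    have h := congrArg (·⁻¹) hmn
    simp only [zmod_inv_inv_of_isUnit (hunit _)] at h
    rw [intCast_two_mul_odd_eq_iff k hc] at h
    have hmod : (m : ℕ) ≡ n [MOD 2 ^ k] := by
      rw [Nat.modEq_iff_dvd]
      exact_mod_cast h
    exact Fin.ext (hmod.eq_of_lt_of_lt m.isLt n.isLt)
  · ext z
    rw [Set.mem_ofPred_eq, ← isUnit_zmod_two_pow_iff_odd_val]
    constructor
    · rintro ⟨n, rfl⟩
      exact isUnit_zmod_inv (hunit n)
    · intro hz
      have hodd : Odd ((z⁻¹).val : ℤ) := by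
        rw [Int.odd_coe_nat]
        exact (isUnit_zmod_two_pow_iff_odd_val k _).1 (isUnit_zmod_inv hz)
      obtain ⟨n, hn, h⟩ := exists_lt_intCast_two_mul_odd_eq k hc hb hodd
      refine ⟨⟨n, hn⟩, ?_⟩
      simp only [h, Int.cast_natCast, ZMod.natCast_zmod_val, zmod_inv_inv_of_isUnit hz]
  · intro n
    rw [(intCast_two_mul_odd_eq_iff k hc b _ n).2 ⟨-1, by ring⟩]
end
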